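/- Suppose k ≥ 2 and S is an optimal assignment map. If S(j) = s for some j ∈ {1,…,ℓ} and s ∈ {1,…,k}, then m(b_s) ≥ n_j and min_{i≠s} ‖y_j − x_i‖ ≥ ρ_α(m(b_s), n_j)·‖y_j − x_s‖. Equivalently, if min_{i≠s} ‖y_j − x_i‖ < ρ_α(m(b_s), n_j)·‖y_j − x_s‖, then S(j) ≠ s. -/

import Mathlib

open scoped BigOperators RealInnerProductSpace

noncomputable section

attribute [local instance] Classical.propDecidable

/-- Points of the ambient Euclidean space `ℝ^m`. -/
abbrev Pt (m : ℕ) := EuclideanSpace ℝ (Fin m)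

/-- A weighted directed graph in `ℝ^m`: a finite vertex set, a finite set of
directed edges (ordered pairs of points, viewed as directed line segments), and
a weight function. -/
structure WDG (m : ℕ) where
  V : Finset (Pt m)
  E : Finset (Pt m × Pt m)
  w : Pt m × Pt m → ℝ

namespace WDG

variable {m : ℕ}

/-- Edges join distinct vertices of the graph and carry positive weight. -/
def edgesOK (G : WDG m) : Prop :=
  ∀ e ∈ G.E, e.1 ∈ G.V ∧ e.2 ∈ G.V ∧ e.1 ≠ e.2 ∧ 0 < G.w e

/-- The underlying undirected (simple) graph. -/
def undirected (G : WDG m) : SimpleGraph (Pt m) :=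
  SimpleGraph.fromRel (fun u v => (u, v) ∈ G.E)

/-- The cost `M_α(G) = Σ_{e ∈ E(G)} w(e)^α · length(e)`. -/
def cost (α : ℝ) (G : WDG m) : ℝ :=
  ∑ e ∈ G.E, (G.w e) ^ α * dist e.1 e.2

/-- Total weight of edges starting at `v`. -/
def outflow (G : WDG m) (v : Pt m) : ℝ :=
  ∑ e ∈ G.E.filter (fun e => e.1 = v), G.w e

/-- Total weight of edges ending at `v`. -/
def inflow (G : WDG m) (v : Pt m) : ℝ :=
  ∑ e ∈ G.E.filter (fun e => e.2 = v), G.w e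

end WDG

/-- Atomic measures are represented as finitely supported functions `ℝ^m →₀ ℝ`
with nonnegative values; `AtomicOn X c` also requires the atoms to lie in `X`. -/
def AtomicOn {m : ℕ} (X : Set (Pt m)) (c : Pt m →₀ ℝ) : Prop :=
  (∀ z, 0 ≤ c z) ∧ ↑c.support ⊆ X

/-- The mass `m(c)` of an atomic measure. -/
def massOf {m : ℕ} (c : Pt m →₀ ℝ) : ℝ := c.sum fun _ t => t

/-- `G` is a transport path from `a` to `b` inside `X`: its vertices lie in `X`
and contain the atoms of `a` and `b`, its underlying undirected graph has no
cycles, and the balance equation holds at every vertex. -/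
def IsTransportPath {m : ℕ} (X : Set (Pt m)) (G : WDG m) (a b : Pt m →₀ ℝ) : Prop :=
  G.edgesOK ∧ ↑G.V ⊆ X ∧
  (∀ z ∈ a.support, z ∈ G.V) ∧ (∀ z ∈ b.support, z ∈ G.V) ∧
  G.undirected.IsAcyclic ∧
  ∀ v : Pt m, G.outflow v - G.inflow v = a v - b v

/-- `d_α(a,b)`: the minimal cost of a transport path from `a` to `b`. -/
def dCost {m : ℕ} (X : Set (Pt m)) (α : ℝ) (a b : Pt m →₀ ℝ) : ℝ :=
  sInf (WDG.cost α '' {G : WDG m | IsTransportPath X G a b})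

/-- An optimal transport path from `a` to `b`. -/
def IsOptimalTP {m : ℕ} (X : Set (Pt m)) (α : ℝ) (G : WDG m) (a b : Pt m →₀ ℝ) : Prop :=
  IsTransportPath X G a b ∧
    ∀ G' : WDG m, IsTransportPath X G' a b → WDG.cost α G ≤ WDG.cost α G'

/-- The atomic probability measure `b = Σ_j n_j δ_{y_j}` of households. -/
def bMeas {m ℓ : ℕ} (y : Fin ℓ → Pt m) (n : Fin ℓ → ℝ) : Pt m →₀ ℝ :=
  ∑ j, Finsupp.single (y j) (n j)

/-- An allocation path from the factory locations `x` to the households `(y,n)`: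
a transport path to `b` from some atomic probability measure supported on the
factory locations. -/
def IsAllocPath {m k ℓ : ℕ} (X : Set (Pt m)) (x : Fin k → Pt m)
    (y : Fin ℓ → Pt m) (n : Fin ℓ → ℝ) (G : WDG m) : Prop :=
  ∃ a : Pt m →₀ ℝ, (∀ z, 0 ≤ a z) ∧ ↑a.support ⊆ Set.range x ∧ massOf a = 1 ∧
    IsTransportPath X G a (bMeas y n)

/-- An optimal allocation path: it minimizes `M_α` over all allocation paths. -/
def IsOptimalAllocPath {m k ℓ : ℕ} (X : Set (Pt m)) (α : ℝ) (x : Fin k → Pt m)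
    (y : Fin ℓ → Pt m) (n : Fin ℓ → ℝ) (G : WDG m) : Prop :=
  IsAllocPath X x y n G ∧
    ∀ G' : WDG m, IsAllocPath X x y n G' → WDG.cost α G ≤ WDG.cost α G'

/-- For an assignment map `S`, the part `b_i = Σ_{j : S(j) = i} n_j δ_{y_j}`. -/
def bPart {m k ℓ : ℕ} (y : Fin ℓ → Pt m) (n : Fin ℓ → ℝ) (S : Fin ℓ → Fin k)
    (i : Fin k) : Pt m →₀ ℝ :=
  ∑ j ∈ Finset.univ.filter (fun j => S j = i), Finsupp.single (y j) (n j)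

/-- The mass `m(b_i) = Σ_{j : S(j) = i} n_j`. -/
def mB {k ℓ : ℕ} (n : Fin ℓ → ℝ) (S : Fin ℓ → Fin k) (i : Fin k) : ℝ :=
  ∑ j ∈ Finset.univ.filter (fun j => S j = i), n j

/-- `E_α(S) = Σ_i d_α(m(b_i) δ_{x_i}, b_i)`. -/
def Ealpha {m k ℓ : ℕ} (X : Set (Pt m)) (α : ℝ) (x : Fin k → Pt m)
    (y : Fin ℓ → Pt m) (n : Fin ℓ → ℝ) (S : Fin ℓ → Fin k) : ℝ :=
  ∑ i, dCost X α (Finsupp.single (x i) (mB n S i)) (bPart y n S i)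

/-- An optimal assignment map minimizes `E_α` over all assignment maps. -/
def IsOptimalAssign {m k ℓ : ℕ} (X : Set (Pt m)) (α : ℝ) (x : Fin k → Pt m)
    (y : Fin ℓ → Pt m) (n : Fin ℓ → ℝ) (S : Fin ℓ → Fin k) : Prop :=
  ∀ S' : Fin ℓ → Fin k, Ealpha X α x y n S ≤ Ealpha X α x y n S'

/-- `ρ_α(σ,ε)`: equals `(σ/ε)^α − (σ/ε − 1)^α` for `σ > ε` (and for `σ = ε` when
`α ∈ (0,1)`), and equals `1` when `σ = ε` (covering also the convention for `α = 0`). -/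
def rho (α σ ε : ℝ) : ℝ :=
  if σ = ε then 1 else (σ / ε) ^ α - (σ / ε - 1) ^ α


/-- `G` is the disjoint union of the subgraphs `Gi`: the `Gi` have pairwise
disjoint vertex sets, each is a subgraph of `G` (with matching weights), and
the edges of `G` are exactly the (disjoint) union of their edges. -/
def IsDisjointUnion {m k : ℕ} (G : WDG m) (Gi : Fin k → WDG m) : Prop :=
  (∀ i i' : Fin k, i ≠ i' → Disjoint (Gi i).V (Gi i').V) ∧
  (∀ i, (Gi i).V ⊆ G.V) ∧
  (∀ i, (Gi i).E ⊆ G.E) ∧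
  (∀ i, ∀ e ∈ (Gi i).E, (Gi i).w e = G.w e) ∧
  G.E = Finset.univ.biUnion (fun i => (Gi i).E)

/-- The projection coordinate `π(z) = ⟨z − p, v⟩` along the line through `p`
in direction `v`. -/
def proj {m : ℕ} (p v z : Pt m) : ℝ := ⟪z - p, v⟫

/-- The constant `C = √(m−1)/(2^{1−(m−1)(1−α)} − 1) + 1`. -/
def Cconst (m : ℕ) (α : ℝ) : ℝ :=
  Real.sqrt ((m : ℝ) - 1) / ((2 : ℝ) ^ (1 - ((m : ℝ) - 1) * (1 - α)) - 1) + 1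


/-! ### The concave power `t ↦ t ^ α`, normalised to vanish at `0` -/

/-- The function `t ↦ t ^ α`, with value `0` at `t = 0` also for `α = 0`. -/
def zpw (α t : ℝ) : ℝ := if t = 0 then 0 else t ^ α

lemma zpw_zero (α : ℝ) : zpw α 0 = 0 := by simp [zpw]

lemma zpw_of_ne {α t : ℝ} (ht : t ≠ 0) : zpw α t = t ^ α := by simp [zpw, ht]

lemma zpw_eq_of_pos {α : ℝ} (hα : 0 < α) (t : ℝ) : zpw α t = t ^ α := by
  rcases eq_or_ne t 0 with rfl | h
  · rw [zpw_zero, Real.zero_rpow hα.ne']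
  · exact zpw_of_ne h

lemma zpw_nonneg {α t : ℝ} (ht : 0 ≤ t) : 0 ≤ zpw α t := by
  unfold zpw
  split_ifs
  · exact le_rfl
  · exact Real.rpow_nonneg ht α

lemma zpw_mono {α s t : ℝ} (hα : 0 ≤ α) (hs : 0 ≤ s) (hst : s ≤ t) : zpw α s ≤ zpw α t := by
  rcases hs.eq_or_lt with rfl | hs'
  · rw [zpw_zero]; exact zpw_nonneg hst
  · rw [zpw_of_ne hs'.ne', zpw_of_ne (hs'.trans_le hst).ne']
    exact Real.rpow_le_rpow hs hst hα

lemma zpw_add_le {α s t : ℝ} (hα : 0 ≤ α) (hα1 : α ≤ 1) (hs : 0 ≤ s) (ht : 0 ≤ t) :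
    zpw α (s + t) ≤ zpw α s + zpw α t := by
  rcases hs.eq_or_lt with rfl | hs'
  · simp [zpw_zero]
  rcases ht.eq_or_lt with rfl | ht'
  · simp [zpw_zero]
  rw [zpw_of_ne hs'.ne', zpw_of_ne ht'.ne', zpw_of_ne (add_pos hs' ht').ne']
  exact Real.rpow_add_le_add_rpow hs ht hα hα1

lemma zpw_concave {α : ℝ} (hα : 0 ≤ α) (hα1 : α ≤ 1) :
    ConcaveOn ℝ (Set.Ici 0) (zpw α) := by
  rcases hα.eq_or_lt with rfl | hα'
  · refine ⟨convex_Ici 0, ?_⟩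
    intro s hs t ht a b ha hb hab
    have hs : 0 ≤ s := hs
    have ht : 0 ≤ t := ht
    simp only [smul_eq_mul, zpw, Real.rpow_zero]
    by_cases h : a * s + b * t = 0
    · have h1 := mul_nonneg ha hs
      have h2 := mul_nonneg hb ht
      have h3 : a * s = 0 := by linarith
      have h4 : b * t = 0 := by linarith
      rcases mul_eq_zero.1 h3 with h3 | h3 <;> rcases mul_eq_zero.1 h4 with h4 | h4 <;>
        simp [h3, h4]
    · rw [if_neg h]
      split_ifs <;> linarith
  · have : zpw α = fun t => t ^ α := funext (zpw_eq_of_pos hα')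
    rw [this]
    exact Real.concaveOn_rpow hα hα1

lemma zpw_sub_le {α n w σ : ℝ} (hα : 0 ≤ α) (hα1 : α ≤ 1) (hn : 0 < n) (hnw : n ≤ w)
    (hwσ : w ≤ σ) : zpw α σ - zpw α (σ - n) ≤ zpw α w - zpw α (w - n) := by
  have hc := (zpw_concave hα hα1).2
  have hd : 0 < σ - w + n := by linarith
  have h1 : (w - n) ∈ Set.Ici (0 : ℝ) := by simpa using hnw
  have h2 : σ ∈ Set.Ici (0 : ℝ) := by simp only [Set.mem_Ici]; linarith
  have ha : 0 ≤ (σ - w) / (σ - w + n) := div_nonneg (by linarith) hd.le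
  have hb : 0 ≤ n / (σ - w + n) := div_nonneg hn.le hd.le
  have hab : (σ - w) / (σ - w + n) + n / (σ - w + n) = 1 := by field_simp
  have k1 := hc h1 h2 ha hb hab
  have k2 := hc h1 h2 hb ha (by linarith)
  simp only [smul_eq_mul] at k1 k2
  have e1 : (σ - w) / (σ - w + n) * (w - n) + n / (σ - w + n) * σ = w := by field_simp; ring
  have e2 : n / (σ - w + n) * (w - n) + (σ - w) / (σ - w + n) * σ = σ - n := by field_simp; ring
  rw [e1] at k1
  rw [e2] at k2
  have e3 : (σ - w) / (σ - w + n) = 1 - n / (σ - w + n) := by linarith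
  rw [e3] at k1 k2
  linarith

lemma zpw_sub_nat_mul_le {α n σ : ℝ} (hα : 0 ≤ α) (hα1 : α ≤ 1) (hn : 0 < n) (k : ℕ) {w : ℝ}
    (hkw : k * n ≤ w) (hwσ : w ≤ σ) :
    k * (zpw α σ - zpw α (σ - n)) ≤ zpw α w - zpw α (w - k * n) := by
  induction k generalizing w with
  | zero => simp
  | succ k ih =>
    push_cast at hkw ⊢
    have hk : 0 ≤ (k : ℝ) * n := by positivity
    have h1 := zpw_sub_le hα hα1 hn (by linarith : n ≤ w) hwσ
    have h2 := ih (by linarith : (k : ℝ) * n ≤ w - n) (by linarith)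
    rw [show w - (k + 1) * n = w - n - k * n by ring]
    linarith

lemma rho_mul_rpow {α σ ε : ℝ} (hε : 0 < ε) (hσ : ε ≤ σ) :
    rho α σ ε * ε ^ α = zpw α σ - zpw α (σ - ε) := by
  unfold rho
  split_ifs with h
  · subst h
    rw [sub_self, zpw_zero, zpw_of_ne hε.ne']; ring
  · have hlt : 0 < σ - ε := sub_pos.2 (lt_of_le_of_ne hσ (Ne.symm h))
    rw [zpw_of_ne (hε.trans_le hσ).ne', zpw_of_ne hlt.ne',
      show σ / ε - 1 = (σ - ε) / ε by field_simp, Real.div_rpow (by linarith) hε.le,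
      Real.div_rpow hlt.le hε.le]
    have := (Real.rpow_pos_of_pos hε α).ne'
    field_simp

/-! ### Edge flows as finitely supported functions -/

section Divergence

variable {V : Type*}

/-- Outflow minus inflow, as a linear map on edge weights. -/
def divergence : (V × V →₀ ℝ) →ₗ[ℝ] (V →₀ ℝ) :=
  Finsupp.lmapDomain ℝ ℝ Prod.fst - Finsupp.lmapDomain ℝ ℝ Prod.snd

lemma divergence_single (e : V × V) (t : ℝ) :
    divergence (Finsupp.single e t) = Finsupp.single e.1 t - Finsupp.single e.2 t := by
  simp [divergence, Finsupp.mapDomain_single]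

lemma linearCombination_divergence (φ : V → ℝ) (F : V × V →₀ ℝ) :
    Finsupp.linearCombination ℝ φ (divergence F) =
      F.sum fun e t => t * (φ e.1 - φ e.2) := by
  simp only [divergence, LinearMap.sub_apply, Finsupp.lmapDomain_apply, map_sub,
    Finsupp.linearCombination_mapDomain]
  simp [Finsupp.linearCombination_apply, Finsupp.sum, mul_sub, Finset.sum_sub_distrib]

/-- A flow is independent if its support carries no nonzero circulation. -/
def Indep (F : V × V →₀ ℝ) : Prop :=
  ∀ Z : V × V →₀ ℝ, Z.support ⊆ F.support → divergence Z = 0 → Z = 0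

/-- One can go from `u` to `v` along directed edges of `F`. -/
def Reaches (F : V × V →₀ ℝ) : V → V → Prop :=
  Relation.ReflTransGen fun u v => (u, v) ∈ F.support

lemma Reaches.exists_chain {F : V × V →₀ ℝ} {u v : V} (h : Reaches F u v) :
    ∃ Z : V × V →₀ ℝ, Z.support ⊆ F.support ∧ (∀ e, ∃ k : ℕ, Z e = k) ∧
      divergence Z = Finsupp.single u 1 - Finsupp.single v 1 := by
  induction h with
  | refl => exact ⟨0, by simp, fun e => ⟨0, by simp⟩, by simp⟩
  | @tail b c _ hbc ih =>
    obtain ⟨Z, hZ, hk, hd⟩ := ih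
    refine ⟨Z + Finsupp.single (b, c) 1, ?_, ?_, ?_⟩
    · refine Finsupp.support_add.trans (Finset.union_subset hZ ?_)
      exact Finsupp.support_single_subset.trans (by simpa using hbc)
    · intro e
      obtain ⟨k, hk⟩ := hk e
      by_cases h : (b, c) = e
      · exact ⟨k + 1, by subst h; simp [hk]⟩
      · exact ⟨k, by simp [hk, h]⟩
    · rw [map_add, hd, divergence_single]; abel

/-- In an independent flow with a single source, every edge weight is at most the source mass and
the flow splits into integral chains from the source to the sinks. -/
lemma Indep.exists_decomposition {F : V × V →₀ ℝ} (hF : ∀ e, 0 ≤ F e) (hI : Indep F)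
    {ι : Type*} (T : Finset ι) (y : ι → V) (n : ι → ℝ) (hn : ∀ i ∈ T, 0 < n i) (x : V)
    (hd : divergence F = Finsupp.single x (∑ i ∈ T, n i) -
      ∑ i ∈ T, Finsupp.single (y i) (n i)) :
    (∀ e, F e ≤ ∑ i ∈ T, n i) ∧
      ∃ Z : ι → V × V →₀ ℝ, (∀ i ∈ T, (Z i).support ⊆ F.support ∧ (∀ e, ∃ k : ℕ, Z i e = k) ∧
        divergence (Z i) = Finsupp.single x 1 - Finsupp.single (y i) 1) ∧
        F = ∑ i ∈ T, n i • Z i := by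
  have key : ∀ φ : V → ℝ, (F.sum fun e t => t * (φ e.1 - φ e.2)) =
      (∑ i ∈ T, n i) * φ x - ∑ i ∈ T, n i * φ (y i) := by
    intro φ
    rw [← linearCombination_divergence, hd]
    simp [Finsupp.linearCombination_single]
  have term : ∀ (u : V) (e : V × V), F e *
      ((if Reaches F u e.1 then (1 : ℝ) else 0) - (if Reaches F u e.2 then 1 else 0)) ≤ 0 := by
    intro u e
    rcases (hF e).eq_or_lt with h0 | h0
    · simp [← h0]
    by_cases h1 : Reaches F u e.1
    · have h2 : Reaches F u e.2 := h1.tail (by simpa using h0.ne')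
      simp [h1, h2]
    · rw [if_neg h1]
      split_ifs <;> linarith
  have reach : ∀ i ∈ T, Reaches F x (y i) := by
    intro i hi
    by_contra hcon
    have h1 := key fun v => if Reaches F x v then (1 : ℝ) else 0
    have h2 : (F.sum fun e t => t * ((if Reaches F x e.1 then (1 : ℝ) else 0) -
      (if Reaches F x e.2 then 1 else 0))) ≤ 0 := Finset.sum_nonpos fun e _ => term x e
    have h3 : Reaches F x x := Relation.ReflTransGen.refl
    have h4 : ∑ j ∈ T, n j * (if Reaches F x (y j) then (1 : ℝ) else 0) < ∑ j ∈ T, n j := by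
      refine Finset.sum_lt_sum (fun j hj => ?_) ⟨i, hi, ?_⟩
      · have := hn j hj
        split_ifs <;> linarith
      · have := hn i hi
        rw [if_neg hcon]; linarith
    simp only [if_pos h3] at h1
    linarith
  refine ⟨fun e => ?_, ?_⟩
  · rcases (hF e).eq_or_lt with h0 | h0
    · rw [← h0]; exact Finset.sum_nonneg fun i hi => (hn i hi).le
    have he : e ∈ F.support := by simpa using h0.ne'
    have hnot : ¬ Reaches F e.2 e.1 := by
      intro hr
      obtain ⟨Z, hZ, hk, hdZ⟩ := hr.exists_chain
      have hz := hI (Z + Finsupp.single e 1)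
        (Finsupp.support_add.trans (Finset.union_subset hZ
          (Finsupp.support_single_subset.trans (by simpa using h0.ne'))))
        (by rw [map_add, hdZ, divergence_single]; abel)
      obtain ⟨k, hk⟩ := hk e
      have := DFunLike.congr_fun hz e
      simp only [Finsupp.add_apply, Finsupp.single_eq_same, Finsupp.coe_zero, Pi.zero_apply,
        hk] at this
      linarith [(Nat.cast_nonneg k : (0 : ℝ) ≤ k)]
    have h1 := key fun v => if Reaches F e.2 v then (1 : ℝ) else 0
    have h2 : (F.sum fun e' t => t * ((if Reaches F e.2 e'.1 then (1 : ℝ) else 0) -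
      (if Reaches F e.2 e'.2 then 1 else 0))) ≤ - F e := by
      rw [Finsupp.sum, ← Finset.add_sum_erase _ _ he]
      have h3 : Reaches F e.2 e.2 := Relation.ReflTransGen.refl
      rw [if_neg hnot, if_pos h3]
      have := Finset.sum_nonpos (s := F.support.erase e) fun e' _ => term e.2 e'
      linarith
    have h4 : ∑ j ∈ T, n j * (if Reaches F e.2 (y j) then (1 : ℝ) else 0) ≤ ∑ j ∈ T, n j := by
      refine Finset.sum_le_sum fun j hj => ?_
      have := hn j hj
      split_ifs <;> linarith
    have h5 : 0 ≤ (∑ j ∈ T, n j) * (if Reaches F e.2 x then (1 : ℝ) else 0) := by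
      have := Finset.sum_nonneg fun i hi => (hn i hi).le
      positivity
    linarith
  · have hex : ∀ i, ∃ Z : V × V →₀ ℝ, i ∈ T → Z.support ⊆ F.support ∧
        (∀ e, ∃ k : ℕ, Z e = k) ∧
        divergence Z = Finsupp.single x 1 - Finsupp.single (y i) 1 := by
      intro i
      by_cases hi : i ∈ T
      · obtain ⟨Z, hZ⟩ := (reach i hi).exists_chain
        exact ⟨Z, fun _ => hZ⟩
      · exact ⟨0, fun h => absurd h hi⟩
    choose Z hZ using hex
    refine ⟨Z, hZ, ?_⟩
    rw [← sub_eq_zero]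
    refine hI _ ?_ ?_
    · intro e he
      by_contra hFe
      have h0 : ∀ i ∈ T, Z i e = 0 := fun i hi => by
        by_contra h
        exact hFe ((hZ i hi).1 (by simpa using h))
      have h1 : F e = 0 := by simpa using hFe
      apply Finsupp.mem_support_iff.1 he
      rw [Finsupp.sub_apply, Finsupp.finsetSum_apply, h1,
        Finset.sum_eq_zero fun i hi => by simp [h0 i hi]]
      simp
    · have hsum : ∑ i ∈ T, divergence (n i • Z i) =
          ∑ i ∈ T, (Finsupp.single x (n i) - Finsupp.single (y i) (n i)) :=
        Finset.sum_congr rfl fun i hi => by rw [map_smul, (hZ i hi).2.2]; simp [smul_sub]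
      rw [map_sub, map_sum, hd, hsum, Finset.sum_sub_distrib, Finsupp.single_finsetSum, sub_self]

/-- An independent flow has an acyclic underlying graph. -/
lemma Indep.isAcyclic {F : V × V →₀ ℝ} (hI : Indep F) :
    (SimpleGraph.fromRel fun u v => (u, v) ∈ F.support).IsAcyclic := by
  set G := SimpleGraph.fromRel fun u v => (u, v) ∈ F.support with hG
  have chain : ∀ (u v a b : V), ((G.deleteEdges {s(a, b)}).Reachable u v) →
      ∃ Z : V × V →₀ ℝ, Z.support ⊆ F.support ∧ Z (a, b) = 0 ∧ Z (b, a) = 0 ∧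
        divergence Z = Finsupp.single u 1 - Finsupp.single v 1 := by
    rintro u v a b ⟨p⟩
    induction p with
    | nil => exact ⟨0, by simp⟩
    | @cons u w v h p ih =>
      obtain ⟨Z, hZ, h1, h2, hd⟩ := ih
      rw [SimpleGraph.deleteEdges_adj, hG, SimpleGraph.fromRel_adj] at h
      obtain ⟨⟨hne, hor⟩, hs⟩ := h
      have hs1 : ¬ (u = a ∧ w = b) := fun hh => hs (by simp [hh.1, hh.2])
      have hs2 : ¬ (u = b ∧ w = a) := fun hh => hs (by simp [hh.1, hh.2, Sym2.eq_swap])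
      rcases hor with hor | hor
      · refine ⟨Z + Finsupp.single (u, w) 1, ?_, ?_, ?_, ?_⟩
        · exact Finsupp.support_add.trans (Finset.union_subset hZ
            (Finsupp.support_single_subset.trans (by simpa using hor)))
        · simp [h1, hs1]
        · simp [h2, hs2]
        · rw [map_add, hd, divergence_single]; abel
      · refine ⟨Z - Finsupp.single (w, u) 1, ?_, ?_, ?_, ?_⟩
        · exact Finsupp.support_sub.trans (Finset.union_subset hZ
            (Finsupp.support_single_subset.trans (by simpa using hor)))
        · simpa [h1, Finsupp.single_apply] using fun h h' => hs2 ⟨h', h⟩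
        · simpa [h2, Finsupp.single_apply] using fun h h' => hs1 ⟨h', h⟩
        · rw [map_sub, hd, divergence_single]; abel
  rw [SimpleGraph.isAcyclic_iff_forall_adj_isBridge]
  intro a b hab
  rw [SimpleGraph.isBridge_iff]
  intro hr
  obtain ⟨Z, hZ, h1, h2, hd⟩ := chain _ _ _ _ hr
  obtain ⟨hne, hor | hor⟩ := (SimpleGraph.fromRel_adj _ _ _).1 hab
  · have hz := hI (Z - Finsupp.single (a, b) 1)
      (Finsupp.support_sub.trans (Finset.union_subset hZ
        (Finsupp.support_single_subset.trans (by simpa using hor))))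
      (by rw [map_sub, hd, divergence_single]; abel)
    simpa [h1] using DFunLike.congr_fun hz (a, b)
  · have hz := hI (Z + Finsupp.single (b, a) 1)
      (Finsupp.support_add.trans (Finset.union_subset hZ
        (Finsupp.support_single_subset.trans (by simpa using hor))))
      (by rw [map_add, hd, divergence_single]; abel)
    simpa [h2] using DFunLike.congr_fun hz (b, a)

end Divergence

/-! ### Cost of a flow -/

section FlowCost

variable {m : ℕ}

/-- The cost `Σ_e F(e)^α · length(e)` over the support of a flow. -/
def flowCost (α : ℝ) (F : Pt m × Pt m →₀ ℝ) : ℝ :=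
  ∑ e ∈ F.support, F e ^ α * dist e.1 e.2

lemma flowCost_eq {α : ℝ} {F : Pt m × Pt m →₀ ℝ} {T : Finset (Pt m × Pt m)}
    (hT : F.support ⊆ T) : flowCost α F = ∑ e ∈ T, zpw α (F e) * dist e.1 e.2 := by
  rw [flowCost, ← Finset.sum_subset hT fun e _ he => by
    rw [Finsupp.notMem_support_iff.1 he, zpw_zero, zero_mul]]
  exact Finset.sum_congr rfl fun e he => by rw [zpw_of_ne (Finsupp.mem_support_iff.1 he)]

lemma flowCost_nonneg {α : ℝ} {F : Pt m × Pt m →₀ ℝ} (hF : ∀ e, 0 ≤ F e) :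
    0 ≤ flowCost α F :=
  Finset.sum_nonneg fun e _ => mul_nonneg (Real.rpow_nonneg (hF e) α) dist_nonneg

lemma flowCost_add_le {α : ℝ} (hα : 0 ≤ α) (hα1 : α ≤ 1) {F G : Pt m × Pt m →₀ ℝ}
    (hF : ∀ e, 0 ≤ F e) (hG : ∀ e, 0 ≤ G e) :
    flowCost α (F + G) ≤ flowCost α F + flowCost α G := by
  rw [flowCost_eq (Finsupp.support_add (g₁ := F) (g₂ := G)),
    flowCost_eq (Finset.subset_union_left (s₁ := F.support) (s₂ := G.support)),
    flowCost_eq (Finset.subset_union_right (s₁ := F.support) (s₂ := G.support)),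
    ← Finset.sum_add_distrib]
  refine Finset.sum_le_sum fun e _ => ?_
  rw [← add_mul]
  exact mul_le_mul_of_nonneg_right (zpw_add_le hα hα1 (hF e) (hG e)) dist_nonneg

lemma flowCost_single {α t : ℝ} (ht : t ≠ 0) (e : Pt m × Pt m) :
    flowCost α (Finsupp.single e t) = t ^ α * dist e.1 e.2 := by
  simp [flowCost, Finsupp.support_single e ht]

/-- A nonnegative flow in `X` without loops and with prescribed divergence. -/
structure IsFlow (X : Set (Pt m)) (F : Pt m × Pt m →₀ ℝ) (c : Pt m →₀ ℝ) : Prop where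
  nonneg : ∀ e, 0 ≤ F e
  edge : ∀ e ∈ F.support, e.1 ∈ X ∧ e.2 ∈ X ∧ e.1 ≠ e.2
  div_eq : divergence F = c

/-- Moving along a direction with a negative entry until some edge weight vanishes. -/
lemma exists_step {V : Type*} {F Z : V →₀ ℝ} (hF : ∀ e, 0 ≤ F e) (hZ : Z.support ⊆ F.support)
    (hneg : ∃ e, Z e < 0) :
    ∃ t : ℝ, 0 < t ∧ (∀ e, 0 ≤ (F + t • Z) e) ∧ (F + t • Z).support ⊂ F.support := by
  obtain ⟨e₁, he₁⟩ := hneg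
  have hpos : ∀ e, Z e ≠ 0 → 0 < F e := fun e he =>
    (hF e).lt_of_ne' (Finsupp.mem_support_iff.1 (hZ (Finsupp.mem_support_iff.2 he)))
  obtain ⟨e₀, he₀, hmin⟩ := (Z.support.filter fun e => Z e < 0).exists_min_image
    (fun e => F e / -Z e) ⟨e₁, by simp [he₁, he₁.ne]⟩
  have hz0 : Z e₀ < 0 := (Finset.mem_filter.1 he₀).2
  have ht : 0 < F e₀ / -Z e₀ := div_pos (hpos _ hz0.ne) (by linarith)
  refine ⟨F e₀ / -Z e₀, ht, fun e => ?_, ?_⟩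
  · simp only [Finsupp.add_apply, Finsupp.smul_apply, smul_eq_mul]
    rcases lt_or_ge (Z e) 0 with h | h
    · have := hmin e (by simp [h, h.ne])
      rw [le_div_iff₀ (by linarith)] at this
      linarith
    · exact add_nonneg (hF e) (mul_nonneg ht.le h)
  · rw [Finset.ssubset_iff_of_subset]
    · refine ⟨e₀, hZ (Finset.mem_filter.1 he₀).1, ?_⟩
      simp only [Finsupp.mem_support_iff, not_not, Finsupp.add_apply, Finsupp.smul_apply,
        smul_eq_mul]
      have : Z e₀ ≠ 0 := hz0.ne
      field_simp
      ring
    · exact Finsupp.support_add.trans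
        (Finset.union_subset subset_rfl (Finsupp.support_smul.trans hZ))

/-- A nonzero circulation allows to shrink the support without increasing the cost. -/
lemma exists_smaller_support {α : ℝ} (hα : 0 ≤ α) (hα1 : α ≤ 1) {F Z : Pt m × Pt m →₀ ℝ}
    (hF : ∀ e, 0 ≤ F e) (hZ : Z.support ⊆ F.support) (hne : Z ≠ 0) (hd : divergence Z = 0) :
    ∃ F' : Pt m × Pt m →₀ ℝ, (∀ e, 0 ≤ F' e) ∧ F'.support ⊂ F.support ∧
      divergence F' = divergence F ∧ flowCost α F' ≤ flowCost α F := by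
  wlog hneg : ∃ e, Z e < 0 generalizing Z
  · push Not at hneg
    refine this (Z := -Z) (by simpa using hZ) (neg_ne_zero.2 hne) (by simp [hd]) ?_
    obtain ⟨e, he⟩ := Finsupp.ne_iff.1 hne
    exact ⟨e, by simpa using (hneg e).lt_of_ne' he⟩
  obtain ⟨t, ht, h1, h2⟩ := exists_step hF hZ hneg
  have hdt : ∀ s : ℝ, divergence (F + s • Z) = divergence F := fun s => by
    rw [map_add, map_smul, hd, smul_zero, add_zero]
  by_cases hposi : ∃ e, 0 < Z e
  · obtain ⟨s, hs, k1, k2⟩ := exists_step (Z := -Z) hF (by simpa using hZ)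
      (by simpa using hposi)
    rw [smul_neg, ← neg_smul] at k1 k2
    have hst : 0 < s + t := by linarith
    have hconc : s / (s + t) * flowCost α (F + t • Z) +
        t / (s + t) * flowCost α (F + (-s) • Z) ≤ flowCost α F := by
      rw [flowCost_eq h2.subset, flowCost_eq k2.subset, flowCost_eq (subset_refl F.support),
        Finset.mul_sum, Finset.mul_sum, ← Finset.sum_add_distrib]
      refine Finset.sum_le_sum fun e _ => ?_
      have := (zpw_concave hα hα1).2 (Set.mem_Ici.2 (h1 e)) (Set.mem_Ici.2 (k1 e))
        (div_nonneg hs.le hst.le) (div_nonneg ht.le hst.le) (by field_simp)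
      have harg : (s / (s + t)) • (F + t • Z) e + (t / (s + t)) • (F + (-s) • Z) e = F e := by
        simp only [Finsupp.add_apply, Finsupp.smul_apply, smul_eq_mul]
        field_simp
        ring
      rw [harg] at this
      simp only [smul_eq_mul] at this
      calc _ = (s / (s + t) * zpw α ((F + t • Z) e) + t / (s + t) * zpw α ((F + (-s) • Z) e)) *
            dist e.1 e.2 := by ring
        _ ≤ _ := mul_le_mul_of_nonneg_right this dist_nonneg
    rcases le_or_gt (flowCost α (F + t • Z)) (flowCost α F) with hc | hc
    · exact ⟨_, h1, h2, hdt t, hc⟩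
    · refine ⟨_, k1, k2, hdt _, ?_⟩
      by_contra! hc'
      have e1 := mul_lt_mul_of_pos_left hc (div_pos hs hst)
      have e2 := mul_lt_mul_of_pos_left hc' (div_pos ht hst)
      have e3 : s / (s + t) * flowCost α F + t / (s + t) * flowCost α F = flowCost α F := by
        field_simp
      linarith
  · push Not at hposi
    refine ⟨_, h1, h2, hdt t, ?_⟩
    rw [flowCost_eq h2.subset, flowCost_eq (subset_refl F.support)]
    refine Finset.sum_le_sum fun e _ => mul_le_mul_of_nonneg_right ?_ dist_nonneg
    refine zpw_mono hα (h1 e) ?_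
    simp only [Finsupp.add_apply, Finsupp.smul_apply, smul_eq_mul]
    linarith [mul_nonpos_of_nonneg_of_nonpos ht.le (hposi e)]

lemma IsFlow.exists_indep {α : ℝ} (hα : 0 ≤ α) (hα1 : α ≤ 1) {X : Set (Pt m)}
    {c : Pt m →₀ ℝ} {F : Pt m × Pt m →₀ ℝ} (hF : IsFlow X F c) :
    ∃ F', IsFlow X F' c ∧ Indep F' ∧ flowCost α F' ≤ flowCost α F := by
  induction hN : F.support.card using Nat.strong_induction_on generalizing F with
  | _ N ih =>
    by_cases hI : Indep F
    · exact ⟨F, hF, hI, le_rfl⟩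
    · simp only [Indep, not_forall] at hI
      obtain ⟨Z, hZ, hd, hne⟩ := hI
      obtain ⟨F₁, h1, h2, h3, h4⟩ := exists_smaller_support hα hα1 hF.nonneg hZ hne hd
      obtain ⟨F', k1, k2, k3⟩ := ih _ (hN ▸ Finset.card_lt_card h2)
        ⟨h1, fun e he => hF.edge e (h2.subset he), h3.trans hF.div_eq⟩ rfl
      exact ⟨F', k1, k2, k3.trans h4⟩

/-! ### Flows and transport paths -/

lemma divergence_apply_sum (E : Finset (Pt m × Pt m)) (w : Pt m × Pt m → ℝ) (v : Pt m) :
    divergence (∑ e ∈ E, Finsupp.single e (w e)) v =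
      ∑ e ∈ E.filter (fun e => e.1 = v), w e - ∑ e ∈ E.filter (fun e => e.2 = v), w e := by
  simp [map_sum, divergence_single, Finset.sum_filter, Finsupp.single_apply,
    Finset.sum_sub_distrib]

lemma IsTransportPath.exists_flow {α : ℝ} {X : Set (Pt m)} {G : WDG m} {a b : Pt m →₀ ℝ}
    (hG : IsTransportPath X G a b) :
    ∃ F, IsFlow X F (a - b) ∧ flowCost α F = G.cost α := by
  obtain ⟨hE, hV, -, -, -, hbal⟩ := hG
  have happ : ∀ e, (∑ e ∈ G.E, Finsupp.single e (G.w e)) e = if e ∈ G.E then G.w e else 0 := by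
    intro e
    simp [Finsupp.finsetSum_apply, Finsupp.single_apply]
  have hsupp : (∑ e ∈ G.E, Finsupp.single e (G.w e)).support = G.E := by
    ext e
    rw [Finsupp.mem_support_iff, happ]
    by_cases he : e ∈ G.E
    · simp [he, (hE e he).2.2.2.ne']
    · simp [he]
  refine ⟨∑ e ∈ G.E, Finsupp.single e (G.w e), ⟨fun e => ?_, fun e he => ?_, ?_⟩, ?_⟩
  · rw [happ]
    split_ifs with he
    · exact (hE e he).2.2.2.le
    · exact le_rfl
  · rw [hsupp] at he
    exact ⟨hV (hE e he).1, hV (hE e he).2.1, (hE e he).2.2.1⟩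
  · ext v
    rw [divergence_apply_sum]
    exact hbal v
  · rw [flowCost, hsupp, WDG.cost]
    exact Finset.sum_congr rfl fun e he => by rw [happ, if_pos he]

lemma IsFlow.exists_transportPath {α : ℝ} {X : Set (Pt m)} {F : Pt m × Pt m →₀ ℝ}
    {a b : Pt m →₀ ℝ} (hF : IsFlow X F (a - b)) (hI : Indep F) (ha : ↑a.support ⊆ X)
    (hb : ↑b.support ⊆ X) : ∃ G, IsTransportPath X G a b ∧ G.cost α = flowCost α F := by
  refine ⟨⟨F.support.image Prod.fst ∪ F.support.image Prod.snd ∪ (a.support ∪ b.support),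
    F.support, F⟩, ⟨?_, ?_, ?_, ?_, hI.isAcyclic, ?_⟩, rfl⟩
  · intro e he
    exact ⟨Finset.mem_union_left _ (Finset.mem_union_left _ (Finset.mem_image_of_mem _ he)),
      Finset.mem_union_left _ (Finset.mem_union_right _ (Finset.mem_image_of_mem _ he)),
      (hF.edge e he).2.2, (hF.nonneg e).lt_of_ne' (Finsupp.mem_support_iff.1 he)⟩
  · intro z hz
    rcases Finset.mem_union.1 (Finset.mem_coe.1 hz) with hz | hz
    · rcases Finset.mem_union.1 hz with hz | hz
      · obtain ⟨e, he, rfl⟩ := Finset.mem_image.1 hz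
        exact (hF.edge e he).1
      · obtain ⟨e, he, rfl⟩ := Finset.mem_image.1 hz
        exact (hF.edge e he).2.1
    · rcases Finset.mem_union.1 hz with hz | hz
      · exact ha hz
      · exact hb hz
  · exact fun z hz => Finset.mem_union_right _ (Finset.mem_union_left _ hz)
  · exact fun z hz => Finset.mem_union_right _ (Finset.mem_union_right _ hz)
  · intro v
    have h := divergence_apply_sum F.support F v
    have hFs : ∑ e ∈ F.support, Finsupp.single e (F e) = F := Finsupp.sum_single F
    rw [hFs, hF.div_eq] at h
    exact h.symm

lemma dCost_le_flowCost {α : ℝ} (hα : 0 ≤ α) (hα1 : α ≤ 1) {X : Set (Pt m)}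
    {F : Pt m × Pt m →₀ ℝ} {a b : Pt m →₀ ℝ} (hF : IsFlow X F (a - b))
    (ha : ↑a.support ⊆ X) (hb : ↑b.support ⊆ X) : dCost X α a b ≤ flowCost α F := by
  obtain ⟨F', hF', hI, hle⟩ := hF.exists_indep hα hα1
  obtain ⟨G, hG, hcost⟩ := hF'.exists_transportPath (α := α) hI ha hb
  have hbdd : BddBelow (WDG.cost α '' {G : WDG m | IsTransportPath X G a b}) := ⟨0, ?_⟩
  · exact (csInf_le hbdd ⟨G, hG, rfl⟩).trans (hcost.trans_le hle)
  rintro _ ⟨G', hG', rfl⟩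
  obtain ⟨F'', hF'', hc⟩ := hG'.exists_flow (α := α)
  exact hc ▸ flowCost_nonneg hF''.nonneg

lemma le_dCost {α : ℝ} (hα : 0 ≤ α) (hα1 : α ≤ 1) {X : Set (Pt m)} {a b : Pt m →₀ ℝ} {r : ℝ}
    (ha : ↑a.support ⊆ X) (hb : ↑b.support ⊆ X) (hne : ∃ F, IsFlow X F (a - b))
    (h : ∀ F, IsFlow X F (a - b) → Indep F → r ≤ flowCost α F) : r ≤ dCost X α a b := by
  obtain ⟨F₀, hF₀⟩ := hne
  obtain ⟨F₁, hF₁, hI₁, -⟩ := hF₀.exists_indep hα hα1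
  obtain ⟨G, hG, -⟩ := hF₁.exists_transportPath (α := α) hI₁ ha hb
  refine le_csInf ⟨_, G, hG, rfl⟩ ?_
  rintro _ ⟨G', hG', rfl⟩
  obtain ⟨F, hF, hc⟩ := hG'.exists_flow (α := α)
  obtain ⟨F', hF', hI, hle⟩ := hF.exists_indep hα hα1
  exact hc ▸ (h F' hF' hI).trans hle

/-! ### Adding and removing a household -/

/-- Shipping an additional mass `t` from `p` to `q` costs at most `t ^ α * dist p q`. -/
lemma IsFlow.exists_add {α : ℝ} (hα : 0 ≤ α) (hα1 : α ≤ 1) {X : Set (Pt m)}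
    {F : Pt m × Pt m →₀ ℝ} {c : Pt m →₀ ℝ} (hF : IsFlow X F c) {p q : Pt m} (hp : p ∈ X)
    (hq : q ∈ X) {t : ℝ} (ht : 0 < t) :
    ∃ F', IsFlow X F' (c + (Finsupp.single p t - Finsupp.single q t)) ∧
      flowCost α F' ≤ flowCost α F + t ^ α * dist p q := by
  rcases eq_or_ne p q with rfl | hpq
  · exact ⟨F, by simpa using hF, by simp⟩
  have hs : ∀ e, 0 ≤ Finsupp.single (p, q) t e := fun e => by
    rw [Finsupp.single_apply]; split_ifs <;> linarith
  refine ⟨F + Finsupp.single (p, q) t, ⟨fun e => add_nonneg (hF.nonneg e) (hs e), ?_, ?_⟩, ?_⟩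
  · intro e he
    rcases Finset.mem_union.1 (Finsupp.support_add he) with he | he
    · exact hF.edge e he
    · rw [Finsupp.support_single _ ht.ne', Finset.mem_singleton] at he
      subst he
      exact ⟨hp, hq, hpq⟩
  · rw [map_add, hF.div_eq, divergence_single]
  · have := flowCost_add_le hα hα1 hF.nonneg hs
    rwa [flowCost_single ht.ne'] at this

variable {ι : Type*} {X : Set (Pt m)} {y : ι → Pt m} {n : ι → ℝ} {x : Pt m} {T : Finset ι}

lemma exists_isFlow (hx : x ∈ X) (hy : ∀ i, y i ∈ X) (hn : ∀ i, 0 < n i) (T : Finset ι) :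
    ∃ F, IsFlow X F
      (Finsupp.single x (∑ i ∈ T, n i) - ∑ i ∈ T, Finsupp.single (y i) (n i)) := by
  induction T using Finset.induction_on with
  | empty => exact ⟨0, ⟨by simp, by simp, by simp⟩⟩
  | insert i T hi ih =>
    obtain ⟨F, hF⟩ := ih
    obtain ⟨F', hF', -⟩ := hF.exists_add zero_le_one le_rfl hx (hy i) (hn i)
    refine ⟨F', ?_⟩
    convert hF' using 1
    rw [Finset.sum_insert hi, Finset.sum_insert hi, Finsupp.single_add]
    abel

lemma support_single_subset (hx : x ∈ X) (t : ℝ) : ↑(Finsupp.single x t).support ⊆ X :=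
  fun z hz => by
    rw [Finset.mem_singleton.1 (Finsupp.support_single_subset hz)]; exact hx

lemma support_sum_single_subset (hy : ∀ i, y i ∈ X) (T : Finset ι) :
    ↑(∑ i ∈ T, Finsupp.single (y i) (n i)).support ⊆ X := by
  intro z hz
  obtain ⟨i, -, hi⟩ := Finset.mem_biUnion.1 (Finsupp.support_finsetSum hz)
  exact support_single_subset (hy i) _ hi

lemma dCost_insert_le [DecidableEq ι] {α : ℝ} (hα : 0 ≤ α) (hα1 : α ≤ 1) (hx : x ∈ X) (hy : ∀ i, y i ∈ X)
    (hn : ∀ i, 0 < n i) {i : ι} (hi : i ∉ T) :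
    dCost X α (Finsupp.single x (∑ i ∈ insert i T, n i))
        (∑ i ∈ insert i T, Finsupp.single (y i) (n i)) ≤
      dCost X α (Finsupp.single x (∑ i ∈ T, n i)) (∑ i ∈ T, Finsupp.single (y i) (n i)) +
        n i ^ α * dist x (y i) := by
  rw [← sub_le_iff_le_add]
  refine le_dCost hα hα1 (support_single_subset hx _) (support_sum_single_subset hy T)
    (exists_isFlow hx hy hn T) fun F hF _ => ?_
  obtain ⟨F', hF', hle⟩ := hF.exists_add hα hα1 hx (hy i) (hn i)
  rw [sub_le_iff_le_add]
  refine (dCost_le_flowCost hα hα1 ?_ (support_single_subset hx _)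
    (support_sum_single_subset hy _)).trans hle
  convert hF' using 1
  rw [Finset.sum_insert hi, Finset.sum_insert hi, Finsupp.single_add]
  abel

lemma dCost_erase_add_le [DecidableEq ι] {α : ℝ} (hα : 0 ≤ α) (hα1 : α ≤ 1) (hx : x ∈ X) (hy : ∀ i, y i ∈ X)
    (hn : ∀ i, 0 < n i) {i : ι} (hi : i ∈ T) :
    dCost X α (Finsupp.single x (∑ j ∈ T.erase i, n j))
        (∑ j ∈ T.erase i, Finsupp.single (y j) (n j)) +
      (zpw α (∑ j ∈ T, n j) - zpw α (∑ j ∈ T, n j - n i)) * dist x (y i) ≤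
    dCost X α (Finsupp.single x (∑ j ∈ T, n j)) (∑ j ∈ T, Finsupp.single (y j) (n j)) := by
  refine le_dCost hα hα1 (support_single_subset hx _) (support_sum_single_subset hy T)
    (exists_isFlow hx hy hn T) fun F hF hI => ?_
  obtain ⟨hσ, Z, hZ, hsum⟩ := hI.exists_decomposition hF.nonneg T y n (fun i _ => hn i) x
    hF.div_eq
  obtain ⟨hZs, hZk, hZd⟩ := hZ i hi
  set σ := ∑ j ∈ T, n j with hσdef
  have hnσ : n i ≤ σ := Finset.single_le_sum (fun j _ => (hn j).le) hi
  have hle : ∀ e, n i * Z i e ≤ F e := by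
    intro e
    have : F e = ∑ j ∈ T, n j * Z j e := by
      conv_lhs => rw [hsum]
      simp [Finsupp.finsetSum_apply]
    rw [this]
    refine Finset.single_le_sum (f := fun j => n j * Z j e) (fun j hj => ?_) hi
    obtain ⟨k, hk⟩ := (hZ j hj).2.1 e
    rw [hk]
    exact mul_nonneg (hn j).le k.cast_nonneg
  have happ : ∀ e, (F - n i • Z i) e = F e - n i * Z i e := fun e => by simp
  have hsupp : (F - n i • Z i).support ⊆ F.support :=
    Finsupp.support_sub.trans (Finset.union_subset subset_rfl (Finsupp.support_smul.trans hZs))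
  have hflow : IsFlow X (F - n i • Z i) (Finsupp.single x (∑ j ∈ T.erase i, n j) -
      ∑ j ∈ T.erase i, Finsupp.single (y j) (n j)) := by
    refine ⟨fun e => ?_, fun e he => hF.edge e (hsupp he), ?_⟩
    · rw [happ]; linarith [hle e]
    · rw [map_sub, map_smul, hZd, hF.div_eq, hσdef, ← Finset.add_sum_erase T n hi,
        ← Finset.add_sum_erase T (fun j => Finsupp.single (y j) (n j)) hi, Finsupp.single_add]
      simp only [smul_sub, Finsupp.smul_single, smul_eq_mul, mul_one]
      abel
  have hlen : dist x (y i) ≤ ∑ e ∈ F.support, Z i e * dist e.1 e.2 := by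
    have h := linearCombination_divergence (fun v => dist v (y i)) (Z i)
    rw [hZd] at h
    simp only [map_sub, Finsupp.linearCombination_single, smul_eq_mul, one_mul, dist_self,
      sub_zero] at h
    rw [h, Finsupp.sum_of_support_subset _ hZs _ (by simp)]
    refine Finset.sum_le_sum fun e _ => ?_
    obtain ⟨k, hk⟩ := hZk e
    rw [hk]
    refine mul_le_mul_of_nonneg_left ?_ k.cast_nonneg
    linarith [dist_triangle e.1 e.2 (y i)]
  have hg : 0 ≤ zpw α σ - zpw α (σ - n i) :=
    sub_nonneg.2 (zpw_mono hα (sub_nonneg.2 hnσ) (by linarith [hn i]))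
  have hcost : flowCost α (F - n i • Z i) + (zpw α σ - zpw α (σ - n i)) *
      ∑ e ∈ F.support, Z i e * dist e.1 e.2 ≤ flowCost α F := by
    rw [flowCost_eq hsupp, flowCost_eq (subset_refl F.support), Finset.mul_sum,
      ← Finset.sum_add_distrib]
    refine Finset.sum_le_sum fun e _ => ?_
    obtain ⟨k, hk⟩ := hZk e
    have h1 := hle e
    rw [happ]
    rw [hk, mul_comm] at h1 ⊢
    have := mul_le_mul_of_nonneg_right
      (zpw_sub_nat_mul_le hα hα1 (hn i) k h1 (hσ e)) (dist_nonneg (x := e.1) (y := e.2))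
    rw [mul_comm (n i)]
    linarith
  have h1 := dCost_le_flowCost hα hα1 hflow (support_single_subset hx _)
    (support_sum_single_subset hy _)
  have h2 := mul_le_mul_of_nonneg_left hlen hg
  linarith

end FlowCost

/-- If an optimal assignment map sends household `j` to factory
`s`, then `m(b_s) ≥ n_j` and `min_(i≠s) ‖y_j − x_i‖ ≥ ρ_α(m(b_s), n_j) ‖y_j − x_s‖`. -/
theorem stmt_9 {m k ℓ : ℕ} (X : Set (Pt m)) (hXc : IsCompact X) (hXconv : Convex ℝ X)
    (α : ℝ) (hα0 : 0 ≤ α) (hα1 : α < 1)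
    (x : Fin k → Pt m) (hxinj : Function.Injective x) (hxX : ∀ i, x i ∈ X)
    (y : Fin ℓ → Pt m) (hyinj : Function.Injective y) (hyX : ∀ j, y j ∈ X)
    (n : Fin ℓ → ℝ) (hn : ∀ j, 0 < n j) (hnsum : ∑ j, n j = 1)
    (hk : 2 ≤ k) (S : Fin ℓ → Fin k) (hS : IsOptimalAssign X α x y n S)
    (j : Fin ℓ) (s : Fin k) (hjs : S j = s) :
    n j ≤ mB n S s ∧
      ∀ i : Fin k, i ≠ s →
        rho α (mB n S s) (n j) * ‖y j - x s‖ ≤ ‖y j - x i‖ := by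
  have hmem : j ∈ Finset.univ.filter (fun j' => S j' = s) := by simp [hjs]
  have hle : n j ≤ mB n S s := Finset.single_le_sum (fun j' _ => (hn j').le) hmem
  refine ⟨hle, fun i his => ?_⟩
  have hs : Finset.univ.filter (fun j' => Function.update S j i j' = s) =
      (Finset.univ.filter (fun j' => S j' = s)).erase j := by
    ext j'
    by_cases h : j' = j
    · subst h; simp [his]
    · simp [h]
  have hi : Finset.univ.filter (fun j' => Function.update S j i j' = i) =
      insert j (Finset.univ.filter (fun j' => S j' = i)) := by
    ext j'
    by_cases h : j' = j
    · subst h; simp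
    · simp [h]
  have hother : ∀ i', i' ≠ i → i' ≠ s →
      Finset.univ.filter (fun j' => Function.update S j i j' = i') =
        Finset.univ.filter (fun j' => S j' = i') := by
    intro i' h1 h2
    ext j'
    by_cases h : j' = j
    · subst h; simp [hjs, h1.symm, h2.symm]
    · simp [Function.update_of_ne h]
  have hopt := hS (Function.update S j i)
  rw [Ealpha, Ealpha, ← sub_nonneg, ← Finset.sum_sub_distrib,
    Finset.sum_eq_add i s his (fun i' _ h => ?_) (by simp) (by simp)] at hopt
  · have hadd := dCost_insert_le (T := Finset.univ.filter (fun j' => S j' = i)) hα0 hα1.le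
      (hxX i) hyX hn (i := j) (by simp [hjs, his.symm])
    have herase := dCost_erase_add_le hα0 hα1.le (hxX s) hyX hn hmem
    simp only [mB, bPart, hs, hi] at hopt
    have hrho := rho_mul_rpow (α := α) (hn j) hle
    rw [mB] at hrho
    rw [mB, ← dist_eq_norm, ← dist_eq_norm, dist_comm (y j), dist_comm (y j)]
    rw [← hrho] at herase
    refine le_of_mul_le_mul_left ?_ (Real.rpow_pos_of_pos (hn j) α)
    linarith
  · simp only [mB, bPart, hother i' h.1 h.2, sub_self]

end
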